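/- Let D be a divisor in ℂ (a function ℂ → ℤ with discrete support) with points (aₙ) of positive and (bₙ) of negative multiplicity, such that the total number of points (with multiplicity) in every closed unit disc is at most C₀. Fix δ < 1/(2C₀). Then every connected component A of the union A(δ) of all discs B(aₙ,δ) and B(bₙ,δ) has diameter at most 2δC₀. -/

import Mathlib

open Metric Set

/-- Let `((aₙ),(bₙ))` be the points of a divisor, with at most `C₀` points (counted with
multiplicity) in each closed unit disc. If `δ < 1/(2C₀)`, then every connected component of
the union `A(δ)` of the discs `B(aₙ,δ)` and `B(bₙ,δ)` has diameter at most `2δC₀`. -/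
theorem stmt5 (a b : ℕ → ℂ) (C₀ : ℕ)
    (hfin : ∀ c : ℂ, ({n | a n ∈ closedBall c 1}.Finite ∧ {n | b n ∈ closedBall c 1}.Finite))
    (hcard : ∀ c : ℂ,
      {n | a n ∈ closedBall c 1}.ncard + {n | b n ∈ closedBall c 1}.ncard ≤ C₀)
    (δ : ℝ) (hδ0 : 0 < δ) (hδ : δ < 1 / (2 * C₀))
    (z : ℂ) (hz : z ∈ (⋃ n, ball (a n) δ) ∪ ⋃ n, ball (b n) δ) :
    Metric.diam (connectedComponentIn ((⋃ n, ball (a n) δ) ∪ ⋃ n, ball (b n) δ) z)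
      ≤ 2 * δ * C₀ := by
  classical
  have hC : 0 < C₀ := by
    rcases Nat.eq_zero_or_pos C₀ with h | h
    · subst h
      simp at hδ
      linarith
    · exact h
  have hCr : (0 : ℝ) < C₀ := by exact_mod_cast hC
  have hδ1 : 2 * δ * C₀ < 1 := by
    rw [lt_div_iff₀ (by positivity)] at hδ
    linarith
  set P : ℕ ⊕ ℕ → ℂ := Sum.elim a b with hP
  have hA : ((⋃ n, ball (a n) δ) ∪ ⋃ n, ball (b n) δ) = ⋃ s, ball (P s) δ := by
    ext w
    simp [hP]
  rw [hA]
  set G : SimpleGraph (ℕ ⊕ ℕ) := SimpleGraph.fromRel (fun i j => dist (P i) (P j) < 2 * δ) with hG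
  have hadj : ∀ i j, G.Adj i j → dist (P i) (P j) < 2 * δ := by
    intro i j h
    rw [hG, SimpleGraph.fromRel_adj] at h
    rcases h.2 with h | h
    · exact h
    · rwa [dist_comm]
  have hpt : ∀ {i j} (p : G.Walk i j) (k : ℕ), k ≤ p.length →
      dist (P i) (P (p.getVert k)) ≤ 2 * δ * k := by
    intro i j p k
    induction k with
    | zero => intro _; simp
    | succ k ih =>
      intro hk
      have h1 := ih (by omega)
      have h2 := hadj _ _ (p.adj_getVert_succ (i := k) (by omega))
      have h3 := dist_triangle (P i) (P (p.getVert k)) (P (p.getVert (k + 1)))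
      push_cast
      linarith
  refine Metric.diam_le_of_forall_dist_le (by positivity) ?_
  intro x hx y hy
  have hsub := connectedComponentIn_subset (⋃ s, ball (P s) δ) z
  obtain ⟨i, hi⟩ := mem_iUnion.1 (hsub hx)
  have key : connectedComponentIn (⋃ s, ball (P s) δ) z ⊆
      ⋃ j ∈ {j | G.Reachable i j}, ball (P j) δ := by
    refine isPreconnected_connectedComponentIn.subset_left_of_subset_union
      (v := ⋃ j ∈ {j | ¬ G.Reachable i j}, ball (P j) δ) ?_ ?_ ?_ ?_ ?_
    · exact isOpen_biUnion fun _ _ => isOpen_ball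
    · exact isOpen_biUnion fun _ _ => isOpen_ball
    · rw [Set.disjoint_left]
      intro w hw hw'
      simp only [mem_iUnion, mem_setOf_eq] at hw hw'
      obtain ⟨j, hj, hwj⟩ := hw
      obtain ⟨k, hk, hwk⟩ := hw'
      apply hk
      by_cases hjk : j = k
      · exact hjk ▸ hj
      · refine hj.trans (SimpleGraph.Adj.reachable ?_)
        rw [hG, SimpleGraph.fromRel_adj]
        refine ⟨hjk, Or.inl ?_⟩
        have := dist_triangle_left (P j) (P k) w
        rw [mem_ball] at hwj hwk
        linarith
    · intro w hw
      obtain ⟨j, hj⟩ := mem_iUnion.1 (hsub hw)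
      by_cases h : G.Reachable i j
      · left
        exact mem_biUnion (show j ∈ {j | G.Reachable i j} from h) hj
      · right
        exact mem_biUnion (show j ∈ {j | ¬ G.Reachable i j} from h) hj
    · exact ⟨x, hx, mem_biUnion (show i ∈ {j | G.Reachable i j} from SimpleGraph.Reachable.refl i) hi⟩
  have hy' := key hy
  simp only [mem_iUnion, mem_setOf_eq] at hy'
  obtain ⟨j, hj, hyj⟩ := hy'
  obtain ⟨p, hp⟩ := hj.exists_isPath
  have hL : p.length + 1 ≤ C₀ := by
    by_contra hcon
    have hCL : C₀ ≤ p.length := by omega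
    obtain ⟨hfa, hfb⟩ := hfin (P i)
    have hc := hcard (P i)
    rw [Set.ncard_eq_toFinset_card _ hfa, Set.ncard_eq_toFinset_card _ hfb,
      ← Finset.card_disjSum] at hc
    have himg : (Finset.range (C₀ + 1)).image p.getVert ⊆ hfa.toFinset.disjSum hfb.toFinset := by
      intro s hs
      obtain ⟨k, hk, rfl⟩ := Finset.mem_image.1 hs
      rw [Finset.mem_range] at hk
      have h1 := hpt p k (by omega)
      have h2 : (k : ℝ) ≤ C₀ := by exact_mod_cast (by omega : k ≤ C₀)
      have h3 : P (p.getVert k) ∈ closedBall (P i) 1 := by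
        rw [mem_closedBall, dist_comm]
        have : 2 * δ * k ≤ 2 * δ * C₀ := by gcongr
        linarith
      rcases hv : p.getVert k with n | n
      · rw [hv] at h3
        rw [Finset.inl_mem_disjSum, Set.Finite.mem_toFinset]
        exact h3
      · rw [hv] at h3
        rw [Finset.inr_mem_disjSum, Set.Finite.mem_toFinset]
        exact h3
    have h4 := Finset.card_le_card himg
    rw [Finset.card_image_of_injOn, Finset.card_range] at h4
    · omega
    · intro k hk l hl hkl
      simp only [Finset.coe_range, mem_Iio] at hk hl
      exact hp.getVert_injOn (show k ≤ p.length by omega) (show l ≤ p.length by omega) hkl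
  have h1 := hpt p p.length le_rfl
  rw [p.getVert_length] at h1
  have h2 : (p.length : ℝ) + 1 ≤ C₀ := by exact_mod_cast hL
  have h3 := dist_triangle4 x (P i) (P j) y
  rw [mem_ball] at hi hyj
  rw [dist_comm] at hyj
  have h5 : 2 * δ * (p.length + 1) ≤ 2 * δ * C₀ := by gcongr
  linarith
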